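/- arXiv:1201.2123 — 3 statements merged into one kernel-verified Lean document; each statement's English description precedes it below -/
import Mathlib

section
/- For every integer k ≥ 1 there exists a constant c depending only on k such that for all integers t ≥ 2 and m ≥ 3, r_k(K_{2,t}; K_m) ≤ c·m²t/(log m)². -/
/-- `hasRamseyK2t k t m N` : every symmetric `(k+1)`-coloring of the edges of the
complete graph on `N` vertices contains a copy of `K_{2,t}` in one of the first `k`
colors or a copy of `K_m` in the last color. -/
def hasRamseyK2t (k t m N : ℕ) : Prop :=
  ∀ c : Fin N → Fin N → Fin (k + 1), (∀ x y, c x y = c y x) →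
    (∃ i : Fin (k + 1), i ≠ Fin.last k ∧
      ∃ A B : Finset (Fin N), Disjoint A B ∧ A.card = 2 ∧ B.card = t ∧
        ∀ a ∈ A, ∀ b ∈ B, c a b = i) ∨
    (∃ S : Finset (Fin N), S.card = m ∧
      ∀ x ∈ S, ∀ y ∈ S, x ≠ y → c x y = Fin.last k)

/-- The multicolor Ramsey number `r_k(K_{2,t}; K_m)`. -/
noncomputable def ramseyK2t (k t m : ℕ) : ℕ := sInf {N | hasRamseyK2t k t m N}

theorem two_mul_sum_card_powerset {α : Type*} (X : Finset α) :
    2 * ∑ Y ∈ X.powerset, Y.card = X.card * 2 ^ X.card := by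
  classical
  induction X using Finset.induction_on with
  | empty => simp
  | insert a X ha ih =>
    rw [Finset.sum_powerset_insert ha, Finset.card_insert_of_notMem ha]
    have : ∑ Y ∈ X.powerset, (insert a Y).card = ∑ Y ∈ X.powerset, (Y.card + 1) :=
      Finset.sum_congr rfl fun Y hY ↦
        Finset.card_insert_of_notMem fun h ↦ ha (Finset.mem_powerset.1 hY h)
    rw [this, Finset.sum_add_distrib, Finset.sum_const, Finset.card_powerset, smul_eq_mul, mul_one,
      pow_succ]
    linarith

theorem log_mul_le_of_pow_two (D x : ℕ) (hD : 1 ≤ D) :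
    (2 ^ x + 1) * (Real.log D / 4) ≤ D + x * 2 ^ x / 2 := by
  have hD' : (0 : ℝ) < D := by exact_mod_cast hD
  have hp : (1 : ℝ) ≤ 2 ^ x := one_le_pow₀ (by norm_num)
  have h1 : Real.log D ≤ x + D / 2 ^ x := by
    have h := Real.log_le_sub_one_of_pos (x := D / 2 ^ x) (by positivity)
    rw [Real.log_div hD'.ne' (by positivity), Real.log_pow] at h
    have := Real.log_two_lt_d9
    have : (x : ℝ) * Real.log 2 ≤ x * 1 := by gcongr; linarith
    linarith
  have h0 : 0 ≤ Real.log D := Real.log_nonneg (by exact_mod_cast hD)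
  calc (2 ^ x + 1) * (Real.log D / 4) ≤ (2 ^ x + 2 ^ x) * ((x + D / 2 ^ x) / 4) := by gcongr
    _ = D / 2 + x * 2 ^ x / 2 := by field_simp; ring
    _ ≤ _ := by linarith

open Classical in
theorem card_mul_log_le_of_triangleFree {V : Type*} (G : SimpleGraph V) (W : Finset V) (D a : ℕ)
    (hD : 1 ≤ D) (hdeg : ∀ v ∈ W, (W.filter (G.Adj v)).card ≤ D)
    (htri : ∀ u ∈ W, ∀ v ∈ W, ∀ w ∈ W, G.Adj u v → G.Adj u w → ¬ G.Adj v w)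
    (hind : ∀ I ⊆ W, G.IsIndepSet (I : Set V) → I.card ≤ a) :
    W.card * Real.log D ≤ 8 * D * a := by
  set ℓ := Real.log D / 4 with hℓ
  set J := W.powerset.filter (fun I : Finset V ↦ G.IsIndepSet (I : Set V)) with hJ
  have hJpos : 0 < J.card := Finset.card_pos.2 ⟨∅, by simp [hJ, SimpleGraph.IsIndepSet]⟩
  let F : V → Finset V → ℝ := fun v I ↦
    (if v ∈ I then (D : ℝ) else 0) + ((I.filter (G.Adj v)).card : ℝ)
  have lower : ∀ v ∈ W, 0 ≤ ∑ I ∈ J, (F v I - ℓ) := by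
    intro v hv
    let C := insert v (W.filter (G.Adj v))
    rw [← Finset.sum_fiberwise_of_maps_to (g := fun I ↦ I \ C)
      (t := J.image (fun I ↦ I \ C)) fun I hI ↦ Finset.mem_image_of_mem _ hI]
    refine Finset.sum_nonneg fun S hS ↦ ?_
    obtain ⟨I₀, hI₀, rfl⟩ := Finset.mem_image.1 hS
    set S := I₀ \ C with hSdef
    simp only [hJ, Finset.mem_filter, Finset.mem_powerset] at hI₀
    have hSW : S ⊆ W := Finset.sdiff_subset.trans hI₀.1
    have hSind : ∀ x ∈ S, ∀ y ∈ S, ¬ G.Adj x y := fun x hx y hy h ↦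
      hI₀.2 (Finset.mem_sdiff.1 hx).1 (Finset.mem_sdiff.1 hy).1 h.ne h
    have hSv : v ∉ S := by simp [hSdef, C]
    have hSN : ∀ x ∈ S, ¬ G.Adj v x := by
      intro x hx h
      exact (Finset.mem_sdiff.1 hx).2 (by simp [C, h, hSW hx])
    let X := W.filter (fun u ↦ G.Adj v u ∧ ∀ x ∈ S, ¬ G.Adj x u)
    have hXmem : ∀ u, u ∈ X ↔ u ∈ W ∧ G.Adj v u ∧ ∀ x ∈ S, ¬ G.Adj x u := by
      intro u; simp [X]
    have hfib : J.filter (fun I ↦ I \ C = S) =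
        insert (insert v S) (X.powerset.image (fun Y ↦ S ∪ Y)) := by
      ext I
      simp only [hJ, Finset.mem_filter, Finset.mem_powerset, Finset.mem_insert, Finset.mem_image]
      constructor
      · rintro ⟨⟨hIW, hI⟩, hIS⟩
        have hSI : S ⊆ I := hIS ▸ Finset.sdiff_subset
        by_cases hvI : v ∈ I
        · left
          ext x
          constructor
          · intro hx
            by_cases hxC : x ∈ C
            · simp only [C, Finset.mem_insert, Finset.mem_filter] at hxC
              rcases hxC with rfl | ⟨_, h⟩
              · simp
              · exact absurd h (hI hvI hx h.ne)
            · exact Finset.mem_insert_of_mem (hIS ▸ Finset.mem_sdiff.2 ⟨hx, hxC⟩)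
          · intro hx
            rcases Finset.mem_insert.1 hx with rfl | hx
            · exact hvI
            · exact hSI hx
        · right
          refine ⟨I ∩ C, ?_, ?_⟩
          · intro u hu
            have ⟨huI, huC⟩ := Finset.mem_inter.1 hu
            simp only [C, Finset.mem_insert, Finset.mem_filter] at huC
            rcases huC with rfl | ⟨huW, h⟩
            · exact absurd huI hvI
            · exact (hXmem u).2 ⟨huW, h, fun x hx hxu ↦ hI (hSI hx) huI hxu.ne hxu⟩
          · rw [← hIS]; exact Finset.sdiff_union_inter I C
      · rintro (rfl | ⟨Y, hY, rfl⟩)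
        · refine ⟨⟨Finset.insert_subset hv hSW, ?_⟩, ?_⟩
          · intro x hx y hy _ h
            simp only [Finset.coe_insert, Set.mem_insert_iff, Finset.mem_coe] at hx hy
            rcases hx with rfl | hx <;> rcases hy with rfl | hy
            · exact h.ne rfl
            · exact hSN y hy h
            · exact hSN x hx h.symm
            · exact hSind x hx y hy h
          · ext x
            simp only [Finset.mem_sdiff, Finset.mem_insert]
            constructor
            · rintro ⟨rfl | h, h'⟩
              · simp [C] at h'
              · exact h
            · exact fun h ↦ ⟨Or.inr h, (Finset.mem_sdiff.1 h).2⟩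
        · have hYX : ∀ u ∈ Y, u ∈ W ∧ G.Adj v u ∧ ∀ x ∈ S, ¬ G.Adj x u :=
            fun u hu ↦ (hXmem u).1 (hY hu)
          refine ⟨⟨Finset.union_subset hSW fun u hu ↦ (hYX u hu).1, ?_⟩, ?_⟩
          · intro x hx y hy _ h
            simp only [Finset.coe_union, Set.mem_union, Finset.mem_coe] at hx hy
            rcases hx with hx | hx <;> rcases hy with hy | hy
            · exact hSind x hx y hy h
            · exact (hYX y hy).2.2 x hx h
            · exact (hYX x hx).2.2 y hy h.symm
            · exact htri v hv x (hYX x hx).1 y (hYX y hy).1 (hYX x hx).2.1 (hYX y hy).2.1 h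
          · ext x
            simp only [Finset.mem_sdiff, Finset.mem_union]
            constructor
            · rintro ⟨h | h, h'⟩
              · exact h
              · exact absurd (by simp [C, hYX x h]) h'
            · exact fun h ↦ ⟨Or.inl h, (Finset.mem_sdiff.1 h).2⟩
    have hXv : v ∉ X := fun h ↦ ((hXmem v).1 h).2.1.ne rfl
    have hXS : Disjoint S X := Finset.disjoint_left.2 fun x hx hx' ↦
      hSN x hx ((hXmem x).1 hx').2.1
    have hSfil : S.filter (G.Adj v) = ∅ := Finset.filter_eq_empty_iff.2 fun x hx ↦ hSN x hx
    rw [hfib, Finset.sum_insert, Finset.sum_image]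
    · have h1 : F v (insert v S) = D := by
        simp [F, Finset.filter_insert, hSfil]
      have h2 : ∀ Y ∈ X.powerset, F v (S ∪ Y) - ℓ = (Y.card : ℝ) - ℓ := by
        intro Y hY
        have hY := Finset.mem_powerset.1 hY
        have : Y.filter (G.Adj v) = Y :=
          Finset.filter_true_of_mem fun u hu ↦ ((hXmem u).1 (hY hu)).2.1
        have hvY : v ∉ Y := fun h ↦ hXv (hY h)
        simp [F, Finset.filter_union, hSfil, this, hSv, hvY]
      rw [h1, Finset.sum_congr rfl h2, Finset.sum_sub_distrib, Finset.sum_const,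
        Finset.card_powerset]
      have h3 : 2 * ∑ Y ∈ X.powerset, (Y.card : ℝ) = X.card * 2 ^ X.card := by
        exact_mod_cast two_mul_sum_card_powerset X
      have h4 := log_mul_le_of_pow_two D X.card hD
      rw [← hℓ] at h4
      rw [nsmul_eq_mul]
      push_cast
      linarith
    · intro Y hY Z hZ h
      have hY := Finset.mem_powerset.1 hY
      have hZ := Finset.mem_powerset.1 hZ
      have key : ∀ T ⊆ X, (S ∪ T) \ S = T := fun T hT ↦
        Finset.union_sdiff_cancel_left (hXS.mono_right hT)
      rw [← key Y hY, ← key Z hZ]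
      exact congrArg (· \ S) h
    · simp only [Finset.mem_image, Finset.mem_powerset, not_exists, not_and]
      intro Y hY h
      have : v ∈ S ∪ Y := h ▸ Finset.mem_insert_self _ _
      rcases Finset.mem_union.1 this with h | h
      · exact hSv h
      · exact hXv (hY h)
  have upper : ∀ I ∈ J, ∑ v ∈ W, F v I ≤ 2 * D * a := by
    intro I hI
    simp only [hJ, Finset.mem_filter, Finset.mem_powerset] at hI
    have hIa : (I.card : ℝ) ≤ a := by exact_mod_cast hind I hI.1 hI.2
    have h1 : ∑ v ∈ W, (if v ∈ I then (D : ℝ) else 0) = I.card * D := by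
      rw [← Finset.sum_filter, Finset.filter_mem_eq_inter, Finset.inter_eq_right.2 hI.1]
      simp
    have h2 : ∑ v ∈ W, (I.filter (G.Adj v)).card ≤ I.card * D := by
      have h := Finset.sum_card_bipartiteAbove_eq_sum_card_bipartiteBelow (s := W) (t := I) G.Adj
      simp only [Finset.bipartiteAbove, Finset.bipartiteBelow] at h
      rw [h, ← smul_eq_mul]
      refine Finset.sum_le_card_nsmul _ _ _ fun u hu ↦ ?_
      simp only [G.adj_comm _ u]
      exact hdeg u (hI.1 hu)
    have h2' : ∑ v ∈ W, ((I.filter (G.Adj v)).card : ℝ) ≤ I.card * D := by exact_mod_cast h2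
    simp only [F, Finset.sum_add_distrib, h1]
    nlinarith
  have h1 : 0 ≤ ∑ v ∈ W, ∑ I ∈ J, (F v I - ℓ) := Finset.sum_nonneg lower
  have h2 : ∑ I ∈ J, ∑ v ∈ W, F v I ≤ J.card * (2 * D * a) := by
    simpa using Finset.sum_le_card_nsmul J _ _ upper
  simp only [Finset.sum_sub_distrib, Finset.sum_const, nsmul_eq_mul] at h1
  rw [Finset.sum_comm] at h1
  have hJ' : (0 : ℝ) < J.card := by exact_mod_cast hJpos
  have h3 : (J.card : ℝ) * (W.card * ℓ) ≤ J.card * (2 * D * a) := by linarith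
  have := le_of_mul_le_mul_left h3 hJ'
  rw [hℓ] at this
  linarith

theorem card_filter_forall_mem_eq_zero_mul {V : Type*} [Fintype V] [DecidableEq V] (q : ℕ)
    [NeZero q] (S : Finset V) :
    (Finset.univ.filter fun χ : V → Fin q ↦ ∀ v ∈ S, χ v = 0).card * q ^ S.card =
      q ^ Fintype.card V := by
  have h : (Finset.univ.filter fun χ : V → Fin q ↦ ∀ v ∈ S, χ v = 0) =
      Fintype.piFinset (fun v ↦ if v ∈ S then {0} else Finset.univ) := by
    ext χ
    simp only [Finset.mem_filter, Finset.mem_univ, true_and, Fintype.mem_piFinset]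
    refine forall_congr' fun v ↦ ?_
    by_cases hv : v ∈ S <;> simp [hv]
  have h2 : ∀ v, (if v ∈ S then ({0} : Finset (Fin q)) else Finset.univ).card =
      if v ∈ S then 1 else q := fun v ↦ by split_ifs <;> simp
  rw [h, Fintype.card_piFinset, Finset.prod_congr rfl fun v _ ↦ h2 v, Finset.prod_ite]
  simp only [Finset.prod_const, one_pow, one_mul, ← pow_add]
  congr 1
  simp [Finset.filter_not, ← Finset.compl_eq_univ_sdiff]

theorem sum_card_filter_forall_mem_eq_zero {V ι : Type*} [Fintype V] [DecidableEq V] (q : ℕ)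
    [NeZero q] (T : Finset ι) (g : ι → Finset V) (j : ℕ) (hg : ∀ i ∈ T, (g i).card = j) :
    ∑ χ : V → Fin q, ((T.filter fun i ↦ ∀ v ∈ g i, χ v = 0).card : ℝ) =
      q ^ Fintype.card V * (T.card / q ^ j) := by
  have hq : (q : ℝ) ≠ 0 := NeZero.ne _
  have h := Finset.sum_card_bipartiteAbove_eq_sum_card_bipartiteBelow
    (s := (Finset.univ : Finset (V → Fin q))) (t := T) (fun χ i ↦ ∀ v ∈ g i, χ v = 0)
  simp only [Finset.bipartiteAbove, Finset.bipartiteBelow] at h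
  have h1 : ∀ i ∈ T, ((Finset.univ.filter fun χ : V → Fin q ↦ ∀ v ∈ g i, χ v = 0).card : ℝ) =
      q ^ Fintype.card V / q ^ j := by
    intro i hi
    rw [eq_div_iff (by positivity), ← hg i hi]
    exact_mod_cast card_filter_forall_mem_eq_zero_mul q (g i)
  rw [← Nat.cast_sum, h, Nat.cast_sum, Finset.sum_congr rfl h1, Finset.sum_const, nsmul_eq_mul]
  ring

open Classical in
theorem exists_triangleFree_subset_of_locallySparse {V : Type*} [Fintype V] (G : SimpleGraph V)
    (M y : ℕ) (hM : 1 ≤ M) (hy : 1 ≤ y) (hN : Fintype.card V = M * y ^ 8)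
    (h : ∀ A : Finset V, (∑ x ∈ A, (A.filter (G.Adj x)).card) ^ 2 ≤ M * A.card ^ 3) :
    ∃ W : Finset V, y ^ 5 ≤ 32 * W.card ∧ (∀ v ∈ W, (W.filter (G.Adj v)).card ≤ 2 * y) ∧
      ∀ u ∈ W, ∀ v ∈ W, ∀ w ∈ W, G.Adj u v → G.Adj u w → ¬ G.Adj v w := by
  let U : Finset V := Finset.univ.filter fun v ↦ (Finset.univ.filter (G.Adj v)).card ≤ 2 * M * y ^ 4
  have hUN : U.card ≤ M * y ^ 8 := hN ▸ Finset.card_le_univ _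
  have hUlow : M * y ^ 8 ≤ 2 * U.card := by
    have h1 := h Finset.univ
    rw [Finset.card_univ, hN] at h1
    have h2 : ∑ x, (Finset.univ.filter (G.Adj x)).card ≤ M ^ 2 * y ^ 12 := by
      rw [← Nat.pow_le_pow_iff_left (n := 2) (by norm_num)]
      exact h1.trans_eq (by ring)
    have h3 : Uᶜ.card * (2 * M * y ^ 4) ≤ ∑ x, (Finset.univ.filter (G.Adj x)).card := by
      rw [← smul_eq_mul]
      refine (Finset.card_nsmul_le_sum _ _ _ fun v hv ↦ ?_).trans
        (Finset.sum_le_sum_of_subset (Finset.subset_univ _))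
      simp only [U, Finset.mem_compl, Finset.mem_filter, Finset.mem_univ, true_and] at hv
      omega
    have h4 : U.card + Uᶜ.card = M * y ^ 8 := hN ▸ Finset.card_add_card_compl U
    have h5 : (M * y ^ 4) * (2 * Uᶜ.card) ≤ (M * y ^ 4) * (M * y ^ 8) := by
      calc _ = Uᶜ.card * (2 * M * y ^ 4) := by ring
        _ ≤ M ^ 2 * y ^ 12 := h3.trans h2
        _ = _ := by ring
    have := Nat.le_of_mul_le_mul_left h5 (by positivity)
    omega
  let A : V → Finset V := fun v ↦ U.filter (G.Adj v)
  have hA : ∀ v ∈ U, (A v).card ≤ 2 * M * y ^ 4 := fun v hv ↦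
    (Finset.card_le_card (Finset.filter_subset_filter _ (Finset.subset_univ _))).trans
      (Finset.mem_filter.1 hv).2
  let E : Finset (Σ _ : V, V) := U.sigma A
  let T : Finset (Σ _ : V, Σ _ : V, V) :=
    U.sigma fun v ↦ (A v).sigma fun a ↦ (A v).filter (G.Adj a)
  have hE : E.card ≤ 2 * M ^ 2 * y ^ 12 := by
    rw [Finset.card_sigma]
    refine (Finset.sum_le_card_nsmul _ _ _ hA).trans ?_
    rw [smul_eq_mul]
    calc _ ≤ M * y ^ 8 * (2 * M * y ^ 4) := by gcongr
      _ = _ := by ring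
  have hT : T.card ≤ 3 * M ^ 3 * y ^ 14 := by
    rw [Finset.card_sigma]
    have h1 : ∀ v ∈ U, ((A v).sigma fun a ↦ (A v).filter (G.Adj a)).card ≤ 3 * M ^ 2 * y ^ 6 := by
      intro v hv
      rw [Finset.card_sigma, ← Nat.pow_le_pow_iff_left (n := 2) (by norm_num)]
      refine (h (A v)).trans ?_
      calc _ ≤ M * (2 * M * y ^ 4) ^ 3 := by gcongr; exact hA v hv
        _ = 8 * (M ^ 4 * y ^ 12) := by ring
        _ ≤ 9 * (M ^ 4 * y ^ 12) := by gcongr; norm_num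
        _ = _ := by ring
    refine (Finset.sum_le_card_nsmul _ _ _ h1).trans ?_
    rw [smul_eq_mul]
    calc _ ≤ M * y ^ 8 * (3 * M ^ 2 * y ^ 6) := by gcongr
      _ = _ := by ring
  let q := 8 * M * y ^ 3
  have hq : 0 < q := by positivity
  have : NeZero q := ⟨hq.ne'⟩
  let R : (V → Fin q) → Finset V := fun χ ↦ U.filter fun i ↦ ∀ v ∈ ({i} : Finset V), χ v = 0
  let E' : (V → Fin q) → Finset (Σ _ : V, V) := fun χ ↦
    E.filter fun i ↦ ∀ v ∈ ({i.1, i.2} : Finset V), χ v = 0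
  let T' : (V → Fin q) → Finset (Σ _ : V, Σ _ : V, V) := fun χ ↦
    T.filter fun i ↦ ∀ v ∈ ({i.1, i.2.1, i.2.2} : Finset V), χ v = 0
  have sumR : ∑ χ, ((R χ).card : ℝ) = q ^ Fintype.card V * (U.card / q ^ 1) :=
    sum_card_filter_forall_mem_eq_zero q U (fun i ↦ {i}) 1 (by simp)
  have sumE : ∑ χ, ((E' χ).card / (2 * y) : ℝ) =
      q ^ Fintype.card V * (E.card / q ^ 2 / (2 * y)) := by
    rw [← Finset.sum_div, ← mul_div_assoc]
    congr 1
    refine sum_card_filter_forall_mem_eq_zero q E (fun i ↦ {i.1, i.2}) 2 ?_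
    simp only [E, A, Finset.mem_sigma, Finset.mem_filter]
    rintro ⟨u, v⟩ ⟨-, -, h1⟩
    exact Finset.card_pair h1.ne
  have sumT : ∑ χ, ((T' χ).card : ℝ) = q ^ Fintype.card V * (T.card / q ^ 3) := by
    refine sum_card_filter_forall_mem_eq_zero q T (fun i ↦ {i.1, i.2.1, i.2.2}) 3 ?_
    simp only [T, A, Finset.mem_sigma, Finset.mem_filter]
    rintro ⟨u, v, w⟩ ⟨-, ⟨-, h1⟩, ⟨-, h2⟩, h3⟩
    exact Finset.card_eq_three.2 ⟨u, v, w, h1.ne, h2.ne, h3.ne, rfl⟩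
  obtain ⟨χ, -, hχ⟩ : ∃ χ ∈ (Finset.univ : Finset (V → Fin q)), (y ^ 5 / 32 : ℝ) ≤
      (R χ).card - (T' χ).card - (E' χ).card / (2 * y) := by
    refine Finset.exists_le_of_sum_le Finset.univ_nonempty ?_
    rw [Finset.sum_sub_distrib, Finset.sum_sub_distrib, sumR, sumE, sumT]
    have hUr : (M * y ^ 8 : ℝ) ≤ 2 * U.card := by exact_mod_cast hUlow
    have hEr : (E.card : ℝ) ≤ 2 * M ^ 2 * y ^ 12 := by exact_mod_cast hE
    have hTr : (T.card : ℝ) ≤ 3 * M ^ 3 * y ^ 14 := by exact_mod_cast hT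
    have hM' : (0 : ℝ) < M := by exact_mod_cast hM
    have hy' : (0 : ℝ) < y := by exact_mod_cast hy
    have hqr : (q : ℝ) = 8 * M * y ^ 3 := by simp [q]
    have h1 : (y ^ 5 / 16 : ℝ) ≤ U.card / q ^ 1 := by
      rw [le_div_iff₀ (by positivity), hqr]
      linarith
    have h2 : (E.card : ℝ) / q ^ 2 / (2 * y) ≤ y ^ 5 / 64 := by
      rw [div_div, div_le_iff₀ (by positivity), hqr]
      linarith
    have h3 : (T.card : ℝ) / q ^ 3 ≤ 3 * y ^ 5 / 512 := by
      rw [div_le_iff₀ (by positivity), hqr]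
      linarith
    have h4 : (0 : ℝ) < y ^ 5 := by positivity
    have h5 : (0 : ℝ) < q ^ Fintype.card V := by positivity
    simp only [Finset.sum_const, Finset.card_univ, Fintype.card_fun, Fintype.card_fin,
      nsmul_eq_mul]
    push_cast
    rw [← mul_sub, ← mul_sub]
    exact mul_le_mul_of_nonneg_left (by linarith) h5.le
  have hRmem : ∀ v, v ∈ R χ ↔ v ∈ U ∧ χ v = 0 := by simp [R]
  let B : Finset V := (R χ).filter fun v ↦ 2 * y < ((R χ).filter (G.Adj v)).card
  let P : Finset V := (T' χ).image Sigma.fst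
  have hB : B.card * (2 * y) ≤ (E' χ).card := by
    have hsub : (B.sigma fun v ↦ (R χ).filter (G.Adj v)) ⊆ E' χ := by
      rintro ⟨a, b⟩ hab
      simp only [B, Finset.mem_sigma, Finset.mem_filter, hRmem] at hab
      simp [E', E, A, hab]
    refine le_trans ?_ (Finset.card_le_card hsub)
    rw [Finset.card_sigma, ← smul_eq_mul]
    exact Finset.card_nsmul_le_sum _ _ _ fun v hv ↦ (Finset.mem_filter.1 hv).2.le
  have hP : P.card ≤ (T' χ).card := Finset.card_image_le
  have hWR : R χ \ (P ∪ B) ⊆ R χ := Finset.sdiff_subset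
  refine ⟨R χ \ (P ∪ B), ?_, ?_, ?_⟩
  · have h1 : (R χ).card ≤ (R χ \ (P ∪ B)).card + (P.card + B.card) := by
      have := Finset.le_card_sdiff (P ∪ B) (R χ)
      have := Finset.card_union_le P B
      omega
    have h1' : ((R χ).card : ℝ) ≤ (R χ \ (P ∪ B)).card + (P.card + B.card) := by exact_mod_cast h1
    have hB' : (B.card : ℝ) ≤ (E' χ).card / (2 * y) := by
      have : (0 : ℝ) < y := by exact_mod_cast hy
      rw [le_div_iff₀ (by positivity)]
      exact_mod_cast hB
    have hP' : (P.card : ℝ) ≤ (T' χ).card := by exact_mod_cast hP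
    have : (y ^ 5 : ℝ) ≤ 32 * (R χ \ (P ∪ B)).card := by linarith
    exact_mod_cast this
  · intro v hv
    refine (Finset.card_le_card (Finset.filter_subset_filter _ hWR)).trans ?_
    by_contra hlt
    exact (Finset.mem_sdiff.1 hv).2
      (Finset.mem_union_right _ (Finset.mem_filter.2 ⟨hWR hv, not_le.1 hlt⟩))
  · intro u hu v hv w hw huv huw hvw
    refine (Finset.mem_sdiff.1 hu).2 (Finset.mem_union_left _ (Finset.mem_image.2
      ⟨⟨u, v, w⟩, ?_, rfl⟩))
    have hu := (hRmem u).1 (hWR hu)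
    have hv := (hRmem v).1 (hWR hv)
    have hw := (hRmem w).1 (hWR hw)
    simp [T', T, A, hu, hv, hw, huv, huw, hvw]

open Classical in
theorem sq_sum_degree_le_of_codegree_le {V : Type*} (r : V → V → Prop) (A : Finset V) (t : ℕ)
    (ht : 1 ≤ t) (hcod : ∀ x ∈ A, ∀ y ∈ A, x ≠ y → (A.filter fun z ↦ r z x ∧ r z y).card ≤ t) :
    (∑ z ∈ A, (A.filter (r z)).card) ^ 2 ≤ 2 * t * A.card ^ 3 := by
  have h1 : ∑ z ∈ A, (A.filter (r z)).card ^ 2 ≤ 2 * t * A.card ^ 2 := by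
    have h := Finset.sum_card_bipartiteAbove_eq_sum_card_bipartiteBelow (s := A) (t := A ×ˢ A)
      (fun z (p : V × V) ↦ r z p.1 ∧ r z p.2)
    simp only [Finset.bipartiteAbove, Finset.bipartiteBelow] at h
    have h' : ∀ z ∈ A, ((A ×ˢ A).filter fun p : V × V ↦ r z p.1 ∧ r z p.2).card =
        (A.filter (r z)).card ^ 2 := by
      intro z _
      rw [Finset.filter_product, Finset.card_product, sq]
    rw [← Finset.sum_congr rfl h', h, Finset.sum_product]
    have h2 : ∀ x ∈ A, ∑ y ∈ A, (A.filter fun z ↦ r z x ∧ r z y).card ≤ 2 * t * A.card := by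
      intro x hx
      rw [← Finset.add_sum_erase A _ hx]
      have h3 := Finset.sum_le_card_nsmul (A.erase x)
        (fun y ↦ (A.filter fun z ↦ r z x ∧ r z y).card) t fun y hy ↦
          hcod x hx y (Finset.mem_of_mem_erase hy) (Finset.ne_of_mem_erase hy).symm
      have h4 : (A.filter fun z ↦ r z x ∧ r z x).card ≤ A.card := Finset.card_filter_le _ _
      have h5 : (A.erase x).card * t ≤ A.card * t := by gcongr; exact Finset.erase_subset _ _
      rw [smul_eq_mul] at h3
      nlinarith
    refine (Finset.sum_le_card_nsmul _ _ _ h2).trans_eq ?_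
    rw [smul_eq_mul]; ring
  calc _ ≤ A.card * ∑ z ∈ A, (A.filter (r z)).card ^ 2 := sq_sum_le_card_mul_sum_sq
    _ ≤ A.card * (2 * t * A.card ^ 2) := by gcongr
    _ = _ := by ring

open Classical in
theorem pow_mul_log_le_of_locallySparse {V : Type*} [Fintype V] (G : SimpleGraph V)
    (M y a : ℕ) (hM : 1 ≤ M) (hy : 1 ≤ y) (hN : Fintype.card V = M * y ^ 8)
    (h : ∀ A : Finset V, (∑ x ∈ A, (A.filter (G.Adj x)).card) ^ 2 ≤ M * A.card ^ 3)
    (hind : ∀ I : Finset V, G.IsIndepSet (I : Set V) → I.card ≤ a) :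
    y ^ 4 * Real.log y ≤ 512 * a := by
  classical
  obtain ⟨W, hW, hdeg, htri⟩ := exists_triangleFree_subset_of_locallySparse G M y hM hy hN
    (by convert h)
  have h1 := card_mul_log_le_of_triangleFree G W (2 * y) a (by omega) (by convert hdeg) htri
    fun I _ ↦ hind I
  have hy0 : (1 : ℝ) ≤ y := by exact_mod_cast hy
  have h2 : Real.log y ≤ Real.log (2 * y : ℕ) := by
    apply Real.log_le_log (by linarith)
    push_cast; linarith
  have h3 : (y : ℝ) ^ 5 ≤ 32 * W.card := by exact_mod_cast hW
  have h4 : 0 ≤ Real.log y := Real.log_nonneg hy0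
  have h5 : (y : ℝ) * (y ^ 4 * Real.log y) ≤ y * (512 * a) := by
    calc (y : ℝ) * (y ^ 4 * Real.log y) = y ^ 5 * Real.log y := by ring
      _ ≤ 32 * W.card * Real.log (2 * y : ℕ) := by gcongr
      _ ≤ 32 * (8 * (2 * y : ℕ) * a) := by linarith
      _ = _ := by push_cast; ring
  exact le_of_mul_le_mul_left h5 (by linarith)

theorem hasRamseyK2t_of_lt (k t m y : ℕ) (hk : 1 ≤ k) (ht : 1 ≤ t) (hy : 1 ≤ y)
    (hm : 512 * (m : ℝ) < y ^ 4 * Real.log y + 512) :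
    hasRamseyK2t k t m (2 * k ^ 2 * t * y ^ 8) := by
  classical
  intro c hc
  by_contra! hcon
  obtain ⟨hK, hS⟩ := hcon
  let r : Fin k → Fin (2 * k ^ 2 * t * y ^ 8) → Fin (2 * k ^ 2 * t * y ^ 8) → Prop :=
    fun i x z ↦ x ≠ z ∧ c x z = i.castSucc
  let G : SimpleGraph (Fin (2 * k ^ 2 * t * y ^ 8)) :=
    { Adj := fun x z ↦ x ≠ z ∧ c x z ≠ Fin.last k
      symm := ⟨fun x z h ↦ ⟨h.1.symm, hc x z ▸ h.2⟩⟩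
      loopless := ⟨fun x h ↦ h.1 rfl⟩ }
  have hcod : ∀ i x z, x ≠ z →
      (Finset.univ.filter fun w : Fin (2 * k ^ 2 * t * y ^ 8) ↦ r i w x ∧ r i w z).card < t := by
    intro i x z hxz
    by_contra! hge
    obtain ⟨B, hB, hBc⟩ := Finset.exists_subset_card_eq hge
    obtain ⟨a, ha, b, hb, hne⟩ := hK i.castSucc (Fin.castSucc_lt_last i).ne {x, z} B
      (by
        rw [Finset.disjoint_left]
        intro w hw hwB
        have := (Finset.mem_filter.1 (hB hwB)).2
        rcases Finset.mem_insert.1 hw with rfl | hw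
        · exact this.1.1 rfl
        · exact this.2.1 (Finset.mem_singleton.1 hw))
      (Finset.card_pair hxz) hBc
    have := (Finset.mem_filter.1 (hB hb)).2
    rcases Finset.mem_insert.1 ha with rfl | ha
    · exact hne (hc _ _ ▸ this.1.2)
    · rw [Finset.mem_singleton.1 ha] at hne
      exact hne (hc _ _ ▸ this.2.2)
  have hsparse : ∀ A : Finset (Fin (2 * k ^ 2 * t * y ^ 8)),
      (∑ x ∈ A, (A.filter (G.Adj x)).card) ^ 2 ≤ 2 * k ^ 2 * t * A.card ^ 3 := by
    intro A
    have h1 : ∀ i, (∑ x ∈ A, (A.filter (r i x)).card) ^ 2 ≤ 2 * t * A.card ^ 3 := fun i ↦ by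
      have hA : ∀ x ∈ A, ∀ z ∈ A, x ≠ z → (A.filter fun w ↦ r i w x ∧ r i w z).card ≤ t :=
        fun x _ z _ hxz ↦ (Finset.card_le_card
          (Finset.filter_subset_filter _ (Finset.subset_univ A))).trans (hcod i x z hxz).le
      convert sq_sum_degree_le_of_codegree_le (r i) A t ht (by convert hA)
    have h2 : ∑ x ∈ A, (A.filter (G.Adj x)).card ≤ ∑ i, ∑ x ∈ A, (A.filter (r i x)).card := by
      rw [Finset.sum_comm]
      refine Finset.sum_le_sum fun x _ ↦ ?_
      refine le_trans (Finset.card_le_card fun z hz ↦ ?_)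
        (Finset.card_biUnion_le (s := (Finset.univ : Finset (Fin k)))
          (t := fun i ↦ A.filter (r i x)))
      obtain ⟨hzA, hxz, hl⟩ := Finset.mem_filter.1 hz
      obtain ⟨i, hi⟩ := Fin.exists_castSucc_eq.2 hl
      exact Finset.mem_biUnion.2 ⟨i, Finset.mem_univ _, Finset.mem_filter.2 ⟨hzA, hxz, hi.symm⟩⟩
    calc _ ≤ (∑ i, ∑ x ∈ A, (A.filter (r i x)).card) ^ 2 := by gcongr
      _ ≤ k * ∑ i : Fin k, (∑ x ∈ A, (A.filter (r i x)).card) ^ 2 := by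
        simpa using sq_sum_le_card_mul_sum_sq (s := (Finset.univ : Finset (Fin k)))
          (f := fun i ↦ ∑ x ∈ A, (A.filter (r i x)).card)
      _ ≤ k * ∑ i : Fin k, 2 * t * A.card ^ 3 := by gcongr with i; exact h1 i
      _ = _ := by simp; ring
  have hM : 1 ≤ 2 * k ^ 2 * t := Nat.one_le_iff_ne_zero.2 (by positivity)
  have hm1 : 1 ≤ m := by
    by_contra! h0
    obtain ⟨x, hx, -⟩ := hS ∅ (by simp; omega)
    simp at hx
  have h := pow_mul_log_le_of_locallySparse G (2 * k ^ 2 * t) y (m - 1) hM hy (by simp)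
    (by convert hsparse) fun I hI ↦ by
      by_contra! hlt
      obtain ⟨S, hSI, hSc⟩ := Finset.exists_subset_card_eq (show m ≤ I.card by omega)
      obtain ⟨x, hx, z, hz, hxz, hne⟩ := hS S hSc
      exact hI (hSI hx) (hSI hz) hxz ⟨hxz, hne⟩
  rw [Nat.cast_sub hm1] at h
  push_cast at h
  linarith

theorem stmt3 (k : ℕ) (hk : 1 ≤ k) :
    ∃ c : ℝ, 0 < c ∧ ∀ t m : ℕ, 2 ≤ t → 3 ≤ m →
      (ramseyK2t k t m : ℝ) ≤ c * m ^ 2 * t / (Real.log m) ^ 2 := by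
  refine ⟨2 * k ^ 2 * (16 * 4096) ^ 2, by positivity, fun t m ht hm ↦ ?_⟩
  set L := Real.log m with hL
  have hm' : (3 : ℝ) ≤ m := by exact_mod_cast hm
  have hL0 : 0 < L := Real.log_pos (by linarith)
  have hLm : L ≤ m := (Real.log_le_sub_one_of_pos (by linarith)).trans (by linarith)
  have hLsq : L ^ 2 ≤ 4 * m := by
    have h1 : L = 2 * Real.log √m := by rw [Real.log_sqrt (by linarith)]; ring
    have h2 : Real.log √m ≤ √m := (Real.log_le_sub_one_of_pos (by positivity)).trans (by linarith)
    have h3 : √(m : ℝ) ^ 2 = m := Real.sq_sqrt (by linarith)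
    nlinarith
  have hex : ∃ y : ℕ, 4096 * (m : ℝ) ≤ y ^ 4 * L := by
    obtain ⟨y, hy⟩ := exists_nat_ge (4096 * m / L)
    refine ⟨y, ?_⟩
    rw [div_le_iff₀ hL0] at hy
    refine hy.trans ?_
    gcongr
    exact_mod_cast Nat.le_self_pow (by norm_num) y
  classical
  obtain ⟨y, hy, hmin⟩ : ∃ y : ℕ, 4096 * (m : ℝ) ≤ y ^ 4 * L ∧
      ∀ z < y, (z : ℝ) ^ 4 * L < 4096 * m :=
    ⟨Nat.find hex, Nat.find_spec hex, fun z hz ↦ not_le.1 (Nat.find_min hex hz)⟩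
  have hy2 : 2 ≤ y := by
    by_contra! hlt
    have : (y : ℝ) ^ 4 ≤ 1 := pow_le_one₀ (by positivity) (by exact_mod_cast (by omega : y ≤ 1))
    nlinarith
  have hy0 : (0 : ℝ) < y := by exact_mod_cast (by omega : 0 < y)
  have hup : (y : ℝ) ^ 4 * L ≤ 16 * 4096 * m := by
    have h1 := hmin (y - 1) (by omega)
    have h2 : (y : ℝ) ≤ 2 * (y - 1 : ℕ) := by exact_mod_cast (by omega : y ≤ 2 * (y - 1))
    calc (y : ℝ) ^ 4 * L ≤ (2 * (y - 1 : ℕ)) ^ 4 * L := by gcongr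
      _ = 16 * ((y - 1 : ℕ) ^ 4 * L) := by ring
      _ ≤ _ := by linarith
  have hlog : L ≤ 8 * Real.log y := by
    have h1 : (m : ℝ) ≤ y ^ 8 := by
      have h2 : (4096 * (m : ℝ)) ^ 2 ≤ y ^ 8 * L ^ 2 := by
        calc (4096 * (m : ℝ)) ^ 2 ≤ (y ^ 4 * L) ^ 2 := by gcongr
          _ = _ := by ring
      have h3 : (y : ℝ) ^ 8 * L ^ 2 ≤ y ^ 8 * (4 * m) := by gcongr
      have h4 : (m : ℝ) * (4 * m) ≤ y ^ 8 * (4 * m) := by nlinarith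
      exact le_of_mul_le_mul_right h4 (by linarith)
    have h5 := Real.log_le_log (by linarith) h1
    rw [Real.log_pow] at h5
    exact_mod_cast h5
  have hram : hasRamseyK2t k t m (2 * k ^ 2 * t * y ^ 8) := by
    refine hasRamseyK2t_of_lt k t m y hk (by omega) (by omega) ?_
    have : (y : ℝ) ^ 4 * L ≤ y ^ 4 * (8 * Real.log y) := by gcongr
    linarith
  have hle : (ramseyK2t k t m : ℝ) ≤ (2 * k ^ 2 * t * y ^ 8 : ℕ) := by
    exact_mod_cast Nat.sInf_le hram
  refine hle.trans ?_
  rw [le_div_iff₀ (by positivity)]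
  push_cast
  calc 2 * (k : ℝ) ^ 2 * t * y ^ 8 * L ^ 2 =
        2 * (k : ℝ) ^ 2 * t * (y ^ 4 * L) ^ 2 := by ring
    _ ≤ 2 * (k : ℝ) ^ 2 * t * (16 * 4096 * m) ^ 2 := by gcongr
    _ = _ := by ring
end

section
/- Let q = p^a be a prime power with q ≡ 0 (mod t) and suppose p is odd. Then the adjacency matrix of G⁺ (the graph on (F_q/H) × F_q* with (ā,x) ~ (b̄,y) iff xy ∈ ā+b̄, H an additive subgroup of order t) has eigenvalue q−1 with multiplicity 1, eigenvalues √q and −√q each with multiplicity (1/2)(q/t − 1)(q − 2), eigenvalues 1 and −1 each with multiplicity (1/2)(q/t − 1), and eigenvalue 0 with multiplicity q − 2. -/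
open scoped Classical

/-- The adjacency relation of the graph `G⁺`. -/
def adjPlus {F : Type} [Field F] (H : AddSubgroup F)
    (v w : (F ⧸ H) × Fˣ) : Prop :=
  (QuotientAddGroup.mk ((v.2 : F) * (w.2 : F)) : F ⧸ H) = v.1 + w.1

/-- The adjacency matrix of `G⁺` (loops give diagonal entries `1`). -/
noncomputable def adjMatrixPlus {F : Type} [Field F] (H : AddSubgroup F) :
    Matrix ((F ⧸ H) × Fˣ) ((F ⧸ H) × Fˣ) ℝ :=
  fun v w => if adjPlus H v w then 1 else 0

open Matrix in
/-- If matrices `E i` commuting with `M` sum to `1` and `M * E i = μ i • E i` for distinct `μ i`,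
then `E i` projects onto the `μ i`-eigenspace of `M`, whose dimension is therefore its trace. -/
theorem finrank_eigenspace_eq_trace {n ι : Type*} [Fintype n] [DecidableEq n] [Fintype ι]
    (M : Matrix n n ℝ) (E : ι → Matrix n n ℝ) (μ : ι → ℝ) (hμ : Function.Injective μ)
    (hmul : ∀ i, M * E i = μ i • E i) (hcomm : ∀ i, E i * M = M * E i) (hsum : ∑ i, E i = 1)
    (i : ι) : (Module.finrank ℝ (Module.End.eigenspace M.mulVecLin (μ i)) : ℝ) = (E i).trace := by
  rw [← Matrix.trace_toLin'_eq,
    LinearMap.IsProj.trace (p := Module.End.eigenspace M.mulVecLin (μ i))]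
  refine ⟨fun v => ?_, fun v hv => ?_⟩
  · rw [Module.End.mem_eigenspace_iff]
    simp [hmul, Matrix.smul_mulVec]
  · rw [Module.End.mem_eigenspace_iff] at hv
    simp only [mulVecLin_apply] at hv
    have h0 : ∀ j, j ≠ i → E j *ᵥ v = 0 := by
      intro j hj
      have h1 : E j *ᵥ (M *ᵥ v) = M *ᵥ (E j *ᵥ v) := by simp [hcomm]
      rw [hv, mulVec_smul, mulVec_mulVec, hmul, smul_mulVec, ← sub_eq_zero, ← sub_smul,
        smul_eq_zero, sub_eq_zero] at h1
      exact h1.resolve_left fun h => hj (hμ h).symm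
    have h2 : ∑ j, E j *ᵥ v = v := by rw [← sum_mulVec, hsum, one_mulVec]
    rwa [Finset.sum_eq_single i (fun j _ hj => h0 j hj) (by simp)] at h2

theorem sum_units_eq {F : Type*} [Field F] [Fintype F] [DecidableEq F] (f : F → ℝ) :
    ∑ z : Fˣ, f z = ∑ w, f w - f 0 := by
  rw [Fintype.sum_eq_add_sum_compl (0 : F), add_sub_cancel_left]
  refine Finset.sum_bij (fun z _ => (z : F)) (by simp) (fun a _ b _ h => Units.ext h) ?_ (by simp)
  intro b hb
  exact ⟨Units.mk0 b (by simpa using hb), by simp⟩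

theorem sum_mk_eq {F : Type*} [AddCommGroup F] [Fintype F] (H : AddSubgroup F) (d : F ⧸ H) :
    ∑ w : F, (if (QuotientAddGroup.mk w : F ⧸ H) = d then (1 : ℝ) else 0) = Nat.card H := by
  induction d using QuotientAddGroup.induction_on with | H a => ?_
  rw [← Equiv.sum_comp (Equiv.addLeft a)]
  have (w : F) : (QuotientAddGroup.mk (a + w) : F ⧸ H) = QuotientAddGroup.mk a ↔ w ∈ H := by
    rw [eq_comm, QuotientAddGroup.eq]; simp
  simp only [Equiv.coe_addLeft, this]
  simp [Nat.card_eq_fintype_card, Fintype.card_subtype]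

theorem sum_units_mk_mul_eq {F : Type*} [Field F] [Fintype F] [DecidableEq F] (H : AddSubgroup F)
    {u : F} (hu : u ≠ 0) (d : F ⧸ H) :
    ∑ z : Fˣ, (if (QuotientAddGroup.mk ((z : F) * u) : F ⧸ H) = d then (1 : ℝ) else 0) =
      Nat.card H - if d = 0 then 1 else 0 := by
  rw [sum_units_eq (fun z => if (QuotientAddGroup.mk (z * u) : F ⧸ H) = d then (1 : ℝ) else 0),
    ← sum_mk_eq H d,
    ← Equiv.sum_comp (Equiv.mulRight₀ u hu) fun w =>
      if (QuotientAddGroup.mk w : F ⧸ H) = d then (1 : ℝ) else 0]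
  simp [eq_comm]

theorem bijective_add_self {F : Type*} [Field F] (p : ℕ) (hp : p.Prime) (hodd : p ≠ 2) [CharP F p]
    (H : AddSubgroup F) : Function.Bijective fun a : F ⧸ H => a + a := by
  obtain ⟨k, hk⟩ := hp.odd_of_ne_two hodd
  have hp0 (a : F ⧸ H) : p • a = 0 := by
    induction a using QuotientAddGroup.induction_on with | H a => ?_
    rw [← QuotientAddGroup.mk_nsmul]; simp
  have h (a : F ⧸ H) : (k + 1) • (a + a) = a := by
    rw [← two_nsmul, smul_smul, show (k + 1) * 2 = p + 1 by omega, succ_nsmul, hp0, zero_add]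
  refine ⟨fun a b hab => ?_, fun a => ⟨(k + 1) • a, ?_⟩⟩
  · rw [← h a, ← h b]
    exact congrArg _ hab
  · exact (smul_add (k + 1) a a).symm.trans (h a)

theorem adjMatrixPlus_apply {F : Type} [Field F] (H : AddSubgroup F) (a b : F ⧸ H) (x y : Fˣ) :
    adjMatrixPlus H (a, x) (b, y) =
      if (QuotientAddGroup.mk ((x : F) * y) : F ⧸ H) = a + b then 1 else 0 := by
  unfold adjMatrixPlus adjPlus
  congr

section Adj

variable {F : Type} [Field F] [Fintype F] [DecidableEq F] (H : AddSubgroup F) [Fintype (F ⧸ H)]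

/-- The all-ones matrix. -/
def onesMatrix : Matrix ((F ⧸ H) × Fˣ) ((F ⧸ H) × Fˣ) ℝ := fun _ _ => 1

/-- The indicator matrix of having equal second coordinates. -/
noncomputable def sndEqMatrix : Matrix ((F ⧸ H) × Fˣ) ((F ⧸ H) × Fˣ) ℝ :=
  fun v w => if v.2 = w.2 then 1 else 0

/-- The indicator matrix of having equal first coordinates. -/
noncomputable def fstEqMatrix : Matrix ((F ⧸ H) × Fˣ) ((F ⧸ H) × Fˣ) ℝ :=
  fun v w => if v.1 = w.1 then 1 else 0

theorem fstEqMatrix_mul_self :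
    fstEqMatrix H * fstEqMatrix H = ((Fintype.card F : ℝ) - 1) • fstEqMatrix H := by
  ext ⟨a, x⟩ ⟨b, y⟩
  by_cases h : a = b <;>
    simp [Matrix.mul_apply, Fintype.sum_prod_type, fstEqMatrix, h, Fintype.card_units,
      Nat.cast_sub Fintype.card_pos]

theorem sndEqMatrix_mul_fstEqMatrix : sndEqMatrix H * fstEqMatrix H = onesMatrix H := by
  ext ⟨a, x⟩ ⟨b, y⟩
  simp [Matrix.mul_apply, Fintype.sum_prod_type, sndEqMatrix, fstEqMatrix, onesMatrix]

theorem fstEqMatrix_mul_sndEqMatrix : fstEqMatrix H * sndEqMatrix H = onesMatrix H := by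
  ext ⟨a, x⟩ ⟨b, y⟩
  simp [Matrix.mul_apply, Fintype.sum_prod_type, sndEqMatrix, fstEqMatrix, onesMatrix]

theorem adjMatrixPlus_mul_sndEqMatrix : adjMatrixPlus H * sndEqMatrix H = onesMatrix H := by
  ext ⟨a, x⟩ ⟨b, y⟩
  simp [Matrix.mul_apply, Fintype.sum_prod_type, sndEqMatrix, adjMatrixPlus_apply, onesMatrix,
    ← sub_eq_iff_eq_add']

theorem sndEqMatrix_mul_adjMatrixPlus : sndEqMatrix H * adjMatrixPlus H = onesMatrix H := by
  ext ⟨a, x⟩ ⟨b, y⟩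
  simp [Matrix.mul_apply, Fintype.sum_prod_type, sndEqMatrix, adjMatrixPlus_apply, onesMatrix,
    ← sub_eq_iff_eq_add]

theorem adjMatrixPlus_mul_fstEqMatrix (a b : F ⧸ H) (x y : Fˣ) :
    (adjMatrixPlus H * fstEqMatrix H) (a, x) (b, y) = Nat.card H - if a + b = 0 then 1 else 0 := by
  rw [← sum_units_mk_mul_eq H x.ne_zero]
  simp [Matrix.mul_apply, Fintype.sum_prod_type_right, fstEqMatrix, adjMatrixPlus_apply, mul_comm]

theorem fstEqMatrix_mul_adjMatrixPlus (a b : F ⧸ H) (x y : Fˣ) :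
    (fstEqMatrix H * adjMatrixPlus H) (a, x) (b, y) = Nat.card H - if a + b = 0 then 1 else 0 := by
  rw [← sum_units_mk_mul_eq H y.ne_zero]
  simp [Matrix.mul_apply, Fintype.sum_prod_type_right, fstEqMatrix, adjMatrixPlus_apply]

theorem adjMatrixPlus_mul_self : adjMatrixPlus H * adjMatrixPlus H =
    (Nat.card H : ℝ) • onesMatrix H - (Nat.card H : ℝ) • sndEqMatrix H +
      (Fintype.card F : ℝ) • (1 : Matrix _ _ ℝ) - fstEqMatrix H := by
  ext ⟨a, x⟩ ⟨b, y⟩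
  have h (z : Fˣ) (c : F ⧸ H) : (QuotientAddGroup.mk ((x : F) * z) : F ⧸ H) = a + c ↔
      (QuotientAddGroup.mk ((x : F) * z) : F ⧸ H) - a = c := sub_eq_iff_eq_add'.symm
  have h' (z : Fˣ) : (QuotientAddGroup.mk ((z : F) * y) : F ⧸ H) =
      QuotientAddGroup.mk ((x : F) * z) - a + b ↔
      (QuotientAddGroup.mk ((z : F) * (x - y)) : F ⧸ H) = a - b := by
    rw [mul_sub, QuotientAddGroup.mk_sub, mul_comm (z : F) x]
    grind
  have h3 : (adjMatrixPlus H * adjMatrixPlus H) (a, x) (b, y) =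
      ∑ z : Fˣ, if (QuotientAddGroup.mk ((z : F) * (x - y)) : F ⧸ H) = a - b then (1 : ℝ)
        else 0 := by
    simp only [Matrix.mul_apply, Fintype.sum_prod_type_right, adjMatrixPlus_apply, h, ← h',
      ite_mul, one_mul, zero_mul]
    simp
  rw [h3]
  by_cases hxy : x = y
  · subst hxy
    by_cases hab : a = b <;>
    simp [hab, onesMatrix, sndEqMatrix, fstEqMatrix, sub_eq_zero,
      Fintype.card_units, Nat.cast_sub Fintype.card_pos, eq_comm (a := (0 : F ⧸ H))]
  · rw [sum_units_mk_mul_eq H (sub_ne_zero.2 fun h => hxy (Units.ext h))]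
    simp [onesMatrix, sndEqMatrix, fstEqMatrix, sub_eq_zero, hxy]

theorem trace_adjMatrixPlus (h2 : Function.Bijective fun a : F ⧸ H => a + a) :
    (adjMatrixPlus H).trace = (Fintype.card F : ℝ) - 1 := by
  simp only [Matrix.trace, Matrix.diag, Fintype.sum_prod_type_right, adjMatrixPlus_apply]
  have h (x : Fˣ) := Function.Bijective.sum_comp h2
    fun b => if (QuotientAddGroup.mk ((x : F) * x) : F ⧸ H) = b then (1 : ℝ) else 0
  simp [h, Fintype.card_units, Nat.cast_sub Fintype.card_pos]

theorem trace_adjMatrixPlus_mul_fstEqMatrix (h2 : Function.Bijective fun a : F ⧸ H => a + a) :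
    (adjMatrixPlus H * fstEqMatrix H).trace = ((Fintype.card F : ℝ) - 1) *
      (Fintype.card (F ⧸ H) * Nat.card H - 1) := by
  simp only [Matrix.trace, Matrix.diag, Fintype.sum_prod_type_right, adjMatrixPlus_mul_fstEqMatrix]
  have h := Function.Bijective.sum_comp h2
    fun b => (Nat.card H : ℝ) - if b = 0 then (1 : ℝ) else 0
  simp only [h]
  simp [mul_sub, Fintype.card_units, Nat.cast_sub Fintype.card_pos]

end Adj

/-- Dimensions of the eigenspaces of a matrix whose square is a combination of `1`, `P`, `R` and
`P * R`, as traces of the spectral projections. -/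
theorem finrank_eigenspaces_of_idempotents {n : Type*} [Fintype n] [DecidableEq n]
    (A P R : Matrix n n ℝ) (q s : ℝ) (hq : 3 ≤ q) (hs : 0 < s) (hsq : s * s = q)
    (hR : R * R = R)
    (hAP : A * P = (q - 1) • (P * R)) (hPA : P * A = (q - 1) • (P * R)) (hRA : R * A = A * R)
    (hA : A * A = (q * (q - 1)) • (P * R) - q • P + q • (1 : Matrix n n ℝ) - (q - 1) • R) :
    let d (μ : ℝ) : ℝ := Module.finrank ℝ (Module.End.eigenspace A.mulVecLin μ)
    d (q - 1) = (P * R).trace ∧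
    d s = ((1 : Matrix n n ℝ).trace - P.trace - R.trace + (P * R).trace) / 2 +
      (A.trace - (A * R).trace) / (2 * s) ∧
    d (-s) = ((1 : Matrix n n ℝ).trace - P.trace - R.trace + (P * R).trace) / 2 -
      (A.trace - (A * R).trace) / (2 * s) ∧
    d 1 = (R.trace - (P * R).trace) / 2 + ((A * R).trace - (q - 1) * (P * R).trace) / 2 ∧
    d (-1) = (R.trace - (P * R).trace) / 2 - ((A * R).trace - (q - 1) * (P * R).trace) / 2 ∧
    d 0 = P.trace - (P * R).trace := by
  have assoc {X Y Z : Matrix n n ℝ} (h : X * Y = Z) (W : Matrix n n ℝ) : X * (Y * W) = Z * W := by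
    rw [← mul_assoc, h]
  have key := finrank_eigenspace_eq_trace A
    ![P * R, (2⁻¹ : ℝ) • (1 - P - R + P * R) + (2 * s)⁻¹ • (A - A * R),
      (2⁻¹ : ℝ) • (1 - P - R + P * R) - (2 * s)⁻¹ • (A - A * R),
      (2⁻¹ : ℝ) • (R - P * R) + (2⁻¹ : ℝ) • (A * R - (q - 1) • (P * R)),
      (2⁻¹ : ℝ) • (R - P * R) - (2⁻¹ : ℝ) • (A * R - (q - 1) • (P * R)), P - P * R]
    ![q - 1, s, -s, 1, -1, 0] ?_ ?_ ?_ ?_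
  · refine ⟨?_, ?_, ?_, ?_, ?_, ?_⟩
    · exact key 0
    · refine (key 1).trans ?_
      simp [Matrix.trace_smul]
      ring
    · refine (key 2).trans ?_
      simp [Matrix.trace_smul]
      ring
    · refine (key 3).trans ?_
      simp [Matrix.trace_smul]
      ring
    · refine (key 4).trans ?_
      simp [Matrix.trace_smul]
      ring
    · refine (key 5).trans ?_
      simp
  · have h1 : 1 < s := by nlinarith
    have h2 : s < q - 1 := by nlinarith
    intro i j hij
    fin_cases i <;> fin_cases j <;> simp at hij ⊢ <;> linarith
  · intro i
    fin_cases i <;>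
    simp [mul_add, mul_sub, add_mul, sub_mul, mul_assoc, hR, hAP, hA, assoc hAP, assoc hA] <;>
    subst hsq <;> match_scalars <;> field_simp <;> ring
  · intro i
    fin_cases i <;>
    simp [mul_add, mul_sub, add_mul, sub_mul, mul_assoc, hR, hAP, hPA, hRA, hA, assoc hAP,
      assoc hPA, assoc hA]
  · simp [Fin.sum_univ_succ]
    module


/-- For odd characteristic, the eigenvalues of `G⁺` with multiplicities:
`q-1` once, `±√q` each `(q/t-1)(q-2)/2` times, `±1` each `(q/t-1)/2` times,
and `0` with multiplicity `q-2`. -/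
theorem stmt11 (p : ℕ) (hp : p.Prime) (hodd : p ≠ 2)
    (F : Type) [Field F] [Fintype F] [DecidableEq F] [CharP F p]
    (t : ℕ) (ht : 2 ≤ t) (hdvd : t ∣ Fintype.card F)
    (H : AddSubgroup F) (hH : Nat.card H = t) [Fintype (F ⧸ H)] :
    let q := Fintype.card F
    let M := (adjMatrixPlus H).mulVecLin
    Module.finrank ℝ (Module.End.eigenspace M ((q : ℝ) - 1)) = 1 ∧
    Module.finrank ℝ (Module.End.eigenspace M (Real.sqrt q)) = (q / t - 1) * (q - 2) / 2 ∧
    Module.finrank ℝ (Module.End.eigenspace M (-Real.sqrt q)) = (q / t - 1) * (q - 2) / 2 ∧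
    Module.finrank ℝ (Module.End.eigenspace M 1) = (q / t - 1) / 2 ∧
    Module.finrank ℝ (Module.End.eigenspace M (-1)) = (q / t - 1) / 2 ∧
    Module.finrank ℝ (Module.End.eigenspace M 0) = q - 2 := by
  intro q M
  have h2 := bijective_add_self p hp hodd H
  obtain ⟨m, hm⟩ : ∃ m : ℝ, m = Fintype.card (F ⧸ H) := ⟨_, rfl⟩
  have hqm : Fintype.card F = Fintype.card (F ⧸ H) * t := by
    rw [← hH, ← Nat.card_eq_fintype_card, ← Nat.card_eq_fintype_card]
    exact AddSubgroup.card_eq_card_quotient_mul_card_addSubgroup H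
  have hm1 : 1 ≤ Fintype.card (F ⧸ H) := Fintype.card_pos
  have hmq : q / t = Fintype.card (F ⧸ H) := by
    change Fintype.card F / t = _
    rw [hqm, Nat.mul_div_cancel _ (by omega)]
  have hq3 : 3 ≤ q := by
    have h3 : (2 : F) ≠ 0 := Ring.two_ne_zero (by rwa [ringChar.eq F p])
    have := Finset.card_le_univ ({0, 1, 2} : Finset F)
    rwa [Finset.card_eq_three.2 ⟨0, 1, 2, by simp, h3.symm, by
      intro h; exact one_ne_zero (α := F) (by linear_combination -h), rfl⟩] at this
  have hqmR : (q : ℝ) = m * t := by rw [hm]; exact_mod_cast hqm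
  have hq3R : (3 : ℝ) ≤ q := by exact_mod_cast hq3
  have hm0 : m ≠ 0 := by rw [hm]; exact_mod_cast (by omega : Fintype.card (F ⧸ H) ≠ 0)
  have hq1 : (q : ℝ) - 1 ≠ 0 := by linarith
  have hKL := sndEqMatrix_mul_fstEqMatrix H
  have hL := fstEqMatrix_mul_self H
  have hPR : (m⁻¹ • sndEqMatrix H) * (((q : ℝ) - 1)⁻¹ • fstEqMatrix H) =
      (m⁻¹ * ((q : ℝ) - 1)⁻¹) • onesMatrix H := by
    rw [smul_mul_smul_comm, hKL]
  have h_mul_inv_mul_inv_eq : (q : ℝ) * (q - 1) * (m⁻¹ * ((q : ℝ) - 1)⁻¹) = t := by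
    field_simp
    rw [hqmR]
  have h_mul_inv_eq : (q : ℝ) * m⁻¹ = t := by
    rw [hqmR]
    field_simp
  have key := finrank_eigenspaces_of_idempotents (adjMatrixPlus H) (m⁻¹ • sndEqMatrix H)
    (((q : ℝ) - 1)⁻¹ • fstEqMatrix H) q (Real.sqrt q) hq3R (Real.sqrt_pos.2 (by linarith))
    (Real.mul_self_sqrt (by linarith))
    (by rw [smul_mul_smul_comm, hL, smul_smul, mul_assoc, inv_mul_cancel₀ hq1, mul_one])
    (by rw [hPR, mul_smul_comm, adjMatrixPlus_mul_sndEqMatrix, smul_smul]; congr 1; field_simp)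
    (by rw [hPR, smul_mul_assoc, sndEqMatrix_mul_adjMatrixPlus, smul_smul]; congr 1; field_simp)
    (by
      rw [smul_mul_assoc, mul_smul_comm]
      congr 1
      ext ⟨a, x⟩ ⟨b, y⟩
      rw [adjMatrixPlus_mul_fstEqMatrix, fstEqMatrix_mul_adjMatrixPlus])
    (by
      rw [hPR, adjMatrixPlus_mul_self, hH]
      simp only [smul_smul]
      rw [h_mul_inv_mul_inv_eq, h_mul_inv_eq, mul_inv_cancel₀ hq1, one_smul])
  have htK : (sndEqMatrix H).trace = m * (q - 1) := by
    simp [Matrix.trace, sndEqMatrix, q, Fintype.card_units, Nat.cast_sub Fintype.card_pos, hm]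
  have htL : (fstEqMatrix H).trace = m * (q - 1) := by
    simp [Matrix.trace, fstEqMatrix, q, Fintype.card_units, Nat.cast_sub Fintype.card_pos, hm]
  have htJ : (onesMatrix H).trace = m * (q - 1) := by
    simp [Matrix.trace, onesMatrix, q, Fintype.card_units, Nat.cast_sub Fintype.card_pos, hm]
  have ht1 : (1 : Matrix ((F ⧸ H) × Fˣ) ((F ⧸ H) × Fˣ) ℝ).trace = m * (q - 1) := by
    simp [Matrix.trace_one, q, Fintype.card_units, Nat.cast_sub Fintype.card_pos, hm]
  have hqF : (Fintype.card F : ℝ) = q := rfl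
  have htAL := trace_adjMatrixPlus_mul_fstEqMatrix H h2
  rw [hH, ← hm, ← hqmR] at htAL
  rw [hPR] at key
  simp only [mul_smul_comm, Matrix.trace_smul, htK, htL, htJ, ht1, trace_adjMatrixPlus H h2, htAL,
    smul_eq_mul] at key
  have h_inv_mul_inv_mul_eq_one : m⁻¹ * ((q : ℝ) - 1)⁻¹ * (m * (q - 1)) = 1 := by field_simp
  have h_inv_mul_eq_sub_one : m⁻¹ * (m * ((q : ℝ) - 1)) = q - 1 := by field_simp
  have h_inv_mul_eq_card : ((q : ℝ) - 1)⁻¹ * (m * ((q : ℝ) - 1)) = m := by field_simp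
  have h_inv_mul_sq_eq : ((q : ℝ) - 1)⁻¹ * (((q : ℝ) - 1) * ((q : ℝ) - 1)) = q - 1 := by field_simp
  simp only [h_inv_mul_inv_mul_eq_one, h_inv_mul_eq_sub_one, h_inv_mul_eq_card, h_inv_mul_sq_eq,
    hqF, sub_self, zero_div, add_zero, sub_zero, mul_one] at key
  have two_mul_nat (d : ℕ) (h : (d : ℝ) = (m * (q - 1) - (q - 1) - m + 1) / 2) :
      d = (Fintype.card (F ⧸ H) - 1) * (q - 2) / 2 := by
    have : d * 2 = (Fintype.card (F ⧸ H) - 1) * (q - 2) := by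
      rify [hm1, show 2 ≤ q by omega]
      rw [h, ← hm]
      ring
    omega
  have sub_one_nat (d : ℕ) (h : (d : ℝ) = (m - 1) / 2) : d = (Fintype.card (F ⧸ H) - 1) / 2 := by
    have : d * 2 = Fintype.card (F ⧸ H) - 1 := by
      rify [hm1]
      rw [h, ← hm]
      ring
    omega
  obtain ⟨hprin, hsqrt, hnegsqrt, hone, hnegone, hzero⟩ := key
  rw [hmq]
  refine ⟨mod_cast hprin, two_mul_nat _ hsqrt, two_mul_nat _ hnegsqrt, sub_one_nat _ hone,
    sub_one_nat _ hnegone, ?_⟩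
  rify [show 2 ≤ q by omega]
  linarith
end

section
/- Let q = p^a be a prime power with q ≡ 1 (mod t) and suppose p is odd. Then the adjacency matrix of G^× (the graph on (F_q*/H) × F_q with (ā,x) ~ (b̄,y) iff x+y ∈ ā·b̄, H the multiplicative subgroup of order t) has eigenvalue q−1 with multiplicity 1, eigenvalues √q and −√q each with multiplicity (1/2)((q−1)/t − 1)(q−1), eigenvalues 1 and −1 each with multiplicity (1/2)(q−1), and eigenvalue 0 with multiplicity (q−1)/t − 1. -/
open scoped Classical

/-- The adjacency relation of the graph `G^×`. -/
def adjTimes {F : Type} [Field F] (H : Subgroup Fˣ)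
    (v w : (Fˣ ⧸ H) × F) : Prop :=
  ∃ u : Fˣ, (u : F) = v.2 + w.2 ∧ (QuotientGroup.mk u : Fˣ ⧸ H) = v.1 * w.1

/-- The adjacency matrix of `G^×` (loops give diagonal entries `1`). -/
noncomputable def adjMatrixTimes {F : Type} [Field F] (H : Subgroup Fˣ) :
    Matrix ((Fˣ ⧸ H) × F) ((Fˣ ⧸ H) × F) ℝ :=
  fun v w => if adjTimes H v w then 1 else 0

open Module Module.End in
/-- If `M` has a complete system of commuting spectral projections `E i`, then the multiplicity
of the eigenvalue `μ i` is the trace of `E i`. -/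
theorem finrank_eigenspace_eq_trace_s19 {V ι : Type*} [AddCommGroup V] [Module ℝ V]
    [FiniteDimensional ℝ V] [Fintype ι] (M : End ℝ V) (E : ι → End ℝ V) (μ : ι → ℝ)
    (hμ : Function.Injective μ) (hsum : ∑ i, E i = 1) (hl : ∀ i, M * E i = μ i • E i)
    (hr : ∀ i, E i * M = μ i • E i) (i : ι) :
    (finrank ℝ (eigenspace M (μ i)) : ℝ) = LinearMap.trace ℝ V (E i) := by
  have hproj : LinearMap.IsProj (eigenspace M (μ i)) (E i) := by
    refine ⟨fun x => ?_, fun x hx => ?_⟩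
    · rw [mem_eigenspace_iff, ← Module.End.mul_apply, hl, LinearMap.smul_apply]
    · rw [mem_eigenspace_iff] at hx
      have hzero : ∀ j, j ≠ i → E j x = 0 := fun j hj => by
        have h := congrArg (fun f : End ℝ V => f x) (hr j)
        simp only [Module.End.mul_apply, hx, map_smul, LinearMap.smul_apply] at h
        rw [← sub_eq_zero, ← sub_smul] at h
        exact (smul_eq_zero.mp h).resolve_left (sub_ne_zero.mpr (hμ.ne hj.symm))
      have h := congrArg (fun f : End ℝ V => f x) hsum
      simp only [LinearMap.sum_apply, Module.End.one_apply] at h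
      rwa [Finset.sum_eq_single i (fun j _ hj => hzero j hj) (by simp)] at h
  exact hproj.trace.symm

/-- Averaging over the first coordinate. -/
noncomputable def averageFst (A B : Type*) [Fintype A] : Module.End ℝ (A × B → ℝ) where
  toFun v z := (Fintype.card A : ℝ)⁻¹ * ∑ a, v (a, z.2)
  map_add' v w := by ext; simp [Finset.sum_add_distrib, mul_add]
  map_smul' c v := by ext; simp [← Finset.mul_sum, mul_left_comm]

/-- Averaging over the second coordinate. -/
noncomputable def averageSnd (A B : Type*) [Fintype B] : Module.End ℝ (A × B → ℝ) where
  toFun v z := (Fintype.card B : ℝ)⁻¹ * ∑ b, v (z.1, b)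
  map_add' v w := by ext; simp [Finset.sum_add_distrib, mul_add]
  map_smul' c v := by ext; simp [← Finset.mul_sum, mul_left_comm]

section Average

variable {A B : Type*}

theorem averageFst_apply [Fintype A] (v : A × B → ℝ) (z : A × B) :
    averageFst A B v z = (Fintype.card A : ℝ)⁻¹ * ∑ a, v (a, z.2) := rfl

theorem averageSnd_apply [Fintype B] (v : A × B → ℝ) (z : A × B) :
    averageSnd A B v z = (Fintype.card B : ℝ)⁻¹ * ∑ b, v (z.1, b) := rfl

theorem averageFst_mul_self [Fintype A] [Nonempty A] :
    averageFst A B * averageFst A B = averageFst A B := by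
  refine LinearMap.ext fun v => funext fun z => ?_
  simp [averageFst_apply]

theorem averageSnd_mul_self [Fintype B] [Nonempty B] :
    averageSnd A B * averageSnd A B = averageSnd A B := by
  refine LinearMap.ext fun v => funext fun z => ?_
  simp [averageSnd_apply]

theorem averageFst_mul_averageFst_mul [Fintype A] [Nonempty A]
    (X : Module.End ℝ (A × B → ℝ)) :
    averageFst A B * (averageFst A B * X) = averageFst A B * X := by
  rw [← mul_assoc, averageFst_mul_self]

theorem averageSnd_mul_averageFst [Fintype A] [Fintype B] :
    averageSnd A B * averageFst A B = averageFst A B * averageSnd A B := by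
  refine LinearMap.ext fun v => funext fun z => ?_
  simp only [Module.End.mul_apply, averageFst_apply, averageSnd_apply, ← Finset.mul_sum]
  rw [Finset.sum_comm, mul_left_comm]

theorem trace_eq_sum_single {ι : Type*} [Fintype ι] [DecidableEq ι]
    (f : Module.End ℝ (ι → ℝ)) :
    LinearMap.trace ℝ _ f = ∑ i, f (Pi.single i 1) i := by
  rw [LinearMap.trace_eq_matrix_trace ℝ (Pi.basisFun ℝ ι), LinearMap.toMatrix_eq_toMatrix']
  simp [Matrix.trace, LinearMap.toMatrix'_apply]

theorem trace_averageFst [Fintype A] [Fintype B] [Nonempty A] :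
    LinearMap.trace ℝ _ (averageFst A B) = Fintype.card B := by
  simp [trace_eq_sum_single, averageFst_apply, Pi.single_apply, Prod.ext_iff]
  field_simp

theorem trace_averageSnd [Fintype A] [Fintype B] [Nonempty B] :
    LinearMap.trace ℝ _ (averageSnd A B) = Fintype.card A := by
  simp [trace_eq_sum_single, averageSnd_apply, Pi.single_apply, Prod.ext_iff]

theorem trace_averageFst_mul_averageSnd [Fintype A] [Fintype B] [Nonempty A] [Nonempty B] :
    LinearMap.trace ℝ _ (averageFst A B * averageSnd A B) = 1 := by
  have h : ∀ (x : A) (y : B) (a : A), ∑ b, (if a = x ∧ b = y then (1 : ℝ) else 0) =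
      if a = x then 1 else 0 := fun x y a => by
    simp [ite_and]
  simp only [trace_eq_sum_single, Module.End.mul_apply, averageFst_apply, averageSnd_apply,
    Pi.single_apply, Prod.ext_iff, Fintype.sum_prod_type, ← Finset.mul_sum, h]
  simp
  field_simp

end Average

/-- The eigenvalues of the adjacency operator. -/
noncomputable def adjEigenvalue (q : ℝ) : Fin 6 → ℝ :=
  ![q - 1, √q, -√q, 1, -1, 0]

theorem adjEigenvalue_injective {q : ℝ} (hq : 3 ≤ q) :
    Function.Injective (adjEigenvalue q) := by
  have hs : √q * √q = q := Real.mul_self_sqrt (by linarith)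
  have h1 : 1 < √q := Real.lt_sqrt_of_sq_lt (by linarith)
  have h2 : √q < q - 1 := by nlinarith
  intro i j hij
  fin_cases i <;> fin_cases j <;> first
    | rfl
    | (simp [adjEigenvalue] at hij <;> linarith)

section Graph

variable {F : Type} [Field F] [Fintype F] (H : Subgroup Fˣ) [Fintype (Fˣ ⧸ H)]

local notation "𝐌" => Matrix.mulVecLin (adjMatrixTimes H)
local notation "𝐏" => averageFst (Fˣ ⧸ H) F
local notation "𝐐" => averageSnd (Fˣ ⧸ H) F

/-- The spectral projections of the adjacency operator. -/
noncomputable def spectralProjection :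
    Fin 6 → Module.End ℝ ((Fˣ ⧸ H) × F → ℝ) :=
  let q : ℝ := Fintype.card F
  ![𝐏 * 𝐐,
    (1 / 2 : ℝ) • (1 - 𝐏 - 𝐐 + 𝐏 * 𝐐) + (1 / (2 * √q)) • (𝐌 - 𝐏 * 𝐌),
    (1 / 2 : ℝ) • (1 - 𝐏 - 𝐐 + 𝐏 * 𝐐) - (1 / (2 * √q)) • (𝐌 - 𝐏 * 𝐌),
    (1 / 2 : ℝ) • (𝐏 - 𝐏 * 𝐐 + (𝐏 * 𝐌 - (q - 1) • (𝐏 * 𝐐))),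
    (1 / 2 : ℝ) • (𝐏 - 𝐏 * 𝐐 - (𝐏 * 𝐌 - (q - 1) • (𝐏 * 𝐐))),
    𝐐 - 𝐏 * 𝐐]

theorem sum_spectralProjection : ∑ i, spectralProjection H i = 1 := by
  simp only [spectralProjection, Fin.sum_univ_six]
  simp
  module

variable [DecidableEq F]

theorem sum_mk_eq_card_mul_sum (f : Fˣ ⧸ H → ℝ) :
    ∑ u : Fˣ, f (QuotientGroup.mk u) = Nat.card H * ∑ a, f a := by
  have hfib : ∀ a : Fˣ ⧸ H,
      (Finset.univ.filter fun u : Fˣ => (QuotientGroup.mk u : Fˣ ⧸ H) = a).card = Nat.card H := by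
    intro a
    have h := Nat.card_congr (QuotientGroup.preimageMkEquivSubgroupProdSet H {a})
    rw [Nat.card_prod] at h
    simp only [Nat.card_unique, mul_one] at h
    rw [← h, ← Fintype.card_subtype, ← Nat.card_eq_fintype_card]
    rfl
  rw [← Finset.sum_fiberwise Finset.univ (fun u : Fˣ => (QuotientGroup.mk u : Fˣ ⧸ H)),
    Finset.mul_sum]
  refine Finset.sum_congr rfl fun a _ => ?_
  rw [Finset.sum_congr rfl fun u hu => congrArg f (Finset.mem_filter.mp hu).2,
    Finset.sum_const, hfib, nsmul_eq_mul]

theorem adjMatrixTimes_mulVecLin_apply (v : (Fˣ ⧸ H) × F → ℝ) (z : (Fˣ ⧸ H) × F) :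
    (adjMatrixTimes H).mulVecLin v z =
      ∑ u : Fˣ, v (QuotientGroup.mk u * z.1⁻¹, (u : F) - z.2) := by
  simp only [Matrix.mulVecLin_apply, Matrix.mulVec, dotProduct, adjMatrixTimes, ite_mul, one_mul,
    zero_mul, ← Finset.sum_filter]
  symm
  refine Finset.sum_bij (fun u _ => (QuotientGroup.mk u * z.1⁻¹, (u : F) - z.2)) ?_ ?_ ?_ ?_
  · intro u _
    simp only [Finset.mem_filter, Finset.mem_univ, true_and]
    exact ⟨u, by simp, by simp⟩
  · intro u _ w _ h
    have h2 := congrArg Prod.snd h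
    exact Units.ext (sub_left_injective h2)
  · rintro ⟨b, y⟩ h
    obtain ⟨u, hu, hb⟩ := (Finset.mem_filter.mp h).2
    refine ⟨u, Finset.mem_univ _, ?_⟩
    simp [hu, hb, mul_comm z.1]
  · intros
    rfl

theorem card_units_cast : (Fintype.card Fˣ : ℝ) = Fintype.card F - 1 := by
  rw [Fintype.card_units, Nat.cast_sub Fintype.card_pos, Nat.cast_one]

theorem natCard_mul_card_quotient :
    (Nat.card H : ℝ) * Fintype.card (Fˣ ⧸ H) = Fintype.card F - 1 := by
  have h := sum_mk_eq_card_mul_sum H (fun _ => 1)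
  simpa [card_units_cast] using h.symm

theorem sum_units_eq_sum_sub (f : F → ℝ) : ∑ u : Fˣ, f u = ∑ x, f x - f 0 := by
  rw [← Finset.sum_erase_eq_sub (Finset.mem_univ 0)]
  refine Finset.sum_bij (fun u _ => (u : F)) (by simp) (fun _ _ _ _ h => Units.ext h) ?_ (by simp)
  intro x hx
  exact ⟨Units.mk0 x (Finset.ne_of_mem_erase hx), by simp, rfl⟩

theorem adj_mul_averageFst : 𝐌 * 𝐏 = 𝐏 * 𝐌 := by
  refine LinearMap.ext fun v => funext fun z => ?_
  simp only [Module.End.mul_apply, averageFst_apply, adjMatrixTimes_mulVecLin_apply,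
    ← Finset.mul_sum]
  rw [Finset.sum_comm (s := (Finset.univ : Finset (Fˣ ⧸ H)))]
  congr 1
  refine Finset.sum_congr rfl fun u _ => ?_
  exact (Equiv.sum_comp ((Equiv.inv _).trans (Equiv.mulLeft (QuotientGroup.mk u : Fˣ ⧸ H)))
    (fun b => v (b, (u : F) - z.2))).symm

theorem sum_quotient_mul_inv (a : Fˣ ⧸ H) (f : Fˣ ⧸ H → ℝ) :
    ∑ u : Fˣ, f (QuotientGroup.mk u * a⁻¹) = Nat.card H * ∑ b, f b := by
  rw [sum_mk_eq_card_mul_sum H (fun b => f (b * a⁻¹))]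
  congr 1
  exact Equiv.sum_comp (Equiv.mulRight a⁻¹) f

theorem natCard_eq : (Nat.card H : ℝ) =
    (Fintype.card F - 1) * (Fintype.card (Fˣ ⧸ H) : ℝ)⁻¹ := by
  rw [← natCard_mul_card_quotient H]
  field_simp

theorem adj_mul_averageSnd : 𝐌 * 𝐐 = ((Fintype.card F : ℝ) - 1) • (𝐏 * 𝐐) := by
  refine LinearMap.ext fun v => funext fun z => ?_
  simp only [Module.End.mul_apply, averageFst_apply, averageSnd_apply,
    adjMatrixTimes_mulVecLin_apply, LinearMap.smul_apply, Pi.smul_apply, smul_eq_mul,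
    ← Finset.mul_sum]
  rw [sum_quotient_mul_inv H z.1 (fun b => ∑ y, v (b, y)), natCard_eq]
  ring

theorem averageSnd_mul_adj : 𝐐 * 𝐌 = ((Fintype.card F : ℝ) - 1) • (𝐏 * 𝐐) := by
  refine LinearMap.ext fun v => funext fun z => ?_
  simp only [Module.End.mul_apply, averageFst_apply, averageSnd_apply,
    adjMatrixTimes_mulVecLin_apply, LinearMap.smul_apply, Pi.smul_apply, smul_eq_mul,
    ← Finset.mul_sum]
  rw [Finset.sum_comm]
  have h : ∀ u : Fˣ, ∑ y : F, v (QuotientGroup.mk u * z.1⁻¹, (u : F) - y) =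
      ∑ y, v (QuotientGroup.mk u * z.1⁻¹, y) := fun u =>
    Equiv.sum_comp (Equiv.subLeft (u : F)) (fun y => v (QuotientGroup.mk u * z.1⁻¹, y))
  simp only [h]
  rw [sum_quotient_mul_inv H z.1 (fun b => ∑ y, v (b, y)), natCard_eq]
  ring

/-- The square of the adjacency operator. -/
theorem adj_mul_self : 𝐌 * 𝐌 = (Fintype.card F : ℝ) • (1 : Module.End ℝ ((Fˣ ⧸ H) × F → ℝ))
    - ((Fintype.card F : ℝ) - 1) • 𝐏 - (Fintype.card F : ℝ) • 𝐐
    + ((Fintype.card F : ℝ) * (Fintype.card F - 1)) • (𝐏 * 𝐐) := by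
  refine LinearMap.ext fun v => funext fun ⟨a, x⟩ => ?_
  have hq : (Fintype.card F : ℝ) ≠ 0 := Nat.cast_ne_zero.mpr Fintype.card_ne_zero
  have hreparam : (𝐌 * 𝐌) v (a, x) =
      ∑ c : Fˣ, ∑ u : Fˣ, v (QuotientGroup.mk c * a, ((c : F) - 1) * u + x) := by
    simp only [Module.End.mul_apply, adjMatrixTimes_mulVecLin_apply]
    rw [Finset.sum_comm (s := (Finset.univ : Finset Fˣ)) (t := (Finset.univ : Finset Fˣ))
      (f := fun c u => v (QuotientGroup.mk c * a, ((c : F) - 1) * u + x))]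
    refine Finset.sum_congr rfl fun u _ => ?_
    rw [← Equiv.sum_comp (Equiv.mulRight u)]
    refine Finset.sum_congr rfl fun c _ => congrArg v (Prod.ext ?_ ?_)
    · simp [mul_assoc, mul_comm a]
    · simp
      ring
  have hinner : ∀ c : Fˣ, ∑ u : Fˣ, v (QuotientGroup.mk c * a, ((c : F) - 1) * u + x) =
      (∑ y, v (QuotientGroup.mk c * a, y) - v (QuotientGroup.mk c * a, x)) +
      if c = 1 then (Fintype.card F : ℝ) * v (a, x) - ∑ y, v (a, y) else 0 := by
    intro c
    rw [sum_units_eq_sum_sub (fun u => v (QuotientGroup.mk c * a, ((c : F) - 1) * u + x))]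
    split_ifs with hc
    · subst hc
      simp
    · have hc' : (c : F) - 1 ≠ 0 := sub_ne_zero.mpr fun h => hc (Units.ext h)
      rw [← Equiv.sum_comp ((Equiv.mulLeft₀ _ hc').trans (Equiv.addRight x))
        (fun y => v (QuotientGroup.mk c * a, y))]
      simp
  have hquot : ∀ f : Fˣ ⧸ H → ℝ,
      ∑ c : Fˣ, f (QuotientGroup.mk c * a) = Nat.card H * ∑ b, f b := fun f => by
    simpa using sum_quotient_mul_inv H a⁻¹ f
  rw [hreparam]
  simp only [hinner, Finset.sum_add_distrib, Finset.sum_sub_distrib]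
  rw [hquot (fun b => ∑ y, v (b, y)), hquot (fun b => v (b, x)), natCard_eq]
  simp only [Finset.sum_ite_eq', Finset.mem_univ, if_true, LinearMap.add_apply,
    LinearMap.sub_apply, LinearMap.smul_apply, Pi.add_apply, Pi.sub_apply, Pi.smul_apply,
    smul_eq_mul, Module.End.mul_apply, Module.End.one_apply, averageFst_apply, averageSnd_apply,
    ← Finset.mul_sum]
  field_simp
  ring

theorem sum_ite_sub_eq (h2 : (2 : F) ≠ 0) (u : F) (r : ℝ) :
    ∑ x : F, (if u - x = x then r else 0) = r := by
  have h : ∀ x : F, u - x = x ↔ u / 2 = x := fun x => by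
    rw [div_eq_iff h2, sub_eq_iff_eq_add, mul_two]
  simp [h]

theorem trace_adj (h2 : (2 : F) ≠ 0) :
    LinearMap.trace ℝ _ 𝐌 = (Fintype.card F : ℝ) - 1 := by
  simp only [trace_eq_sum_single, adjMatrixTimes_mulVecLin_apply, Pi.single_apply, Prod.ext_iff,
    Fintype.sum_prod_type]
  have h : ∀ a : Fˣ ⧸ H, ∑ x : F, ∑ u : Fˣ,
      (if QuotientGroup.mk u * a⁻¹ = a ∧ (u : F) - x = x then (1 : ℝ) else 0) = Nat.card H := by
    intro a
    rw [Finset.sum_comm]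
    simp only [and_comm (a := _ = a), ite_and, sum_ite_sub_eq h2]
    rw [sum_quotient_mul_inv H a (fun b => if b = a then (1 : ℝ) else 0)]
    simp
  simp only [h]
  rw [Finset.sum_const, nsmul_eq_mul, ← natCard_mul_card_quotient H, Finset.card_univ, mul_comm]

theorem trace_averageFst_mul_adj (h2 : (2 : F) ≠ 0) :
    LinearMap.trace ℝ _ (𝐏 * 𝐌) = (Fintype.card F : ℝ) - 1 := by
  simp only [trace_eq_sum_single, Module.End.mul_apply, averageFst_apply,
    adjMatrixTimes_mulVecLin_apply, Pi.single_apply, Prod.ext_iff, Fintype.sum_prod_type,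
    ← Finset.mul_sum]
  have h : ∀ a : Fˣ ⧸ H, ∑ x : F, ∑ b : Fˣ ⧸ H, ∑ u : Fˣ,
      (if QuotientGroup.mk u * b⁻¹ = a ∧ (u : F) - x = x then (1 : ℝ) else 0) =
        (Fintype.card F : ℝ) - 1 := by
    intro a
    rw [Finset.sum_comm]
    have hb : ∀ b : Fˣ ⧸ H, ∑ x : F, ∑ u : Fˣ,
        (if QuotientGroup.mk u * b⁻¹ = a ∧ (u : F) - x = x then (1 : ℝ) else 0) =
          Nat.card H := by
      intro b
      rw [Finset.sum_comm]
      simp only [and_comm (a := _ = a), ite_and, sum_ite_sub_eq h2]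
      rw [sum_quotient_mul_inv H b (fun b => if b = a then (1 : ℝ) else 0)]
      simp
    simp only [hb]
    rw [Finset.sum_const, nsmul_eq_mul, ← natCard_mul_card_quotient H, Finset.card_univ, mul_comm]
  simp only [h, Finset.sum_const, Finset.card_univ, nsmul_eq_mul]
  field_simp

theorem adj_mul_averageFst_mul (X : Module.End ℝ ((Fˣ ⧸ H) × F → ℝ)) :
    𝐌 * (𝐏 * X) = 𝐏 * (𝐌 * X) := by
  rw [← mul_assoc, adj_mul_averageFst, mul_assoc]

theorem adj_mul_spectralProjection (i : Fin 6) :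
    𝐌 * spectralProjection H i = adjEigenvalue (Fintype.card F) i • spectralProjection H i := by
  have hs : √(Fintype.card F : ℝ) ^ 2 = Fintype.card F := Real.sq_sqrt (Nat.cast_nonneg _)
  have hs0 : √(Fintype.card F : ℝ) ≠ 0 :=
    (Real.sqrt_pos.mpr (Nat.cast_pos.mpr Fintype.card_pos)).ne'
  generalize hS : √(Fintype.card F : ℝ) = s at hs hs0
  fin_cases i <;>
  simp [spectralProjection, adjEigenvalue, hS, mul_add, mul_sub, adj_mul_averageFst,
    adj_mul_averageFst_mul, adj_mul_averageSnd, adj_mul_self, averageFst_mul_self,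
    averageFst_mul_averageFst_mul, -mul_inv_rev] <;>
  (try simp only [← hs]) <;> match_scalars <;> field_simp <;> ring

theorem spectralProjection_mul_adj (i : Fin 6) :
    spectralProjection H i * 𝐌 = adjEigenvalue (Fintype.card F) i • spectralProjection H i := by
  have hs : √(Fintype.card F : ℝ) ^ 2 = Fintype.card F := Real.sq_sqrt (Nat.cast_nonneg _)
  have hs0 : √(Fintype.card F : ℝ) ≠ 0 :=
    (Real.sqrt_pos.mpr (Nat.cast_pos.mpr Fintype.card_pos)).ne'
  generalize hS : √(Fintype.card F : ℝ) = s at hs hs0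
  fin_cases i <;>
  simp [spectralProjection, adjEigenvalue, hS, add_mul, sub_mul, mul_add, mul_sub, mul_assoc,
    averageSnd_mul_adj, adj_mul_self, averageFst_mul_self,
    averageFst_mul_averageFst_mul, -mul_inv_rev] <;>
  (try simp only [← hs]) <;> match_scalars <;> field_simp <;> ring

theorem trace_spectralProjection (h2 : (2 : F) ≠ 0) (i : Fin 6) :
    LinearMap.trace ℝ _ (spectralProjection H i) =
      (![1, ((Fintype.card (Fˣ ⧸ H) : ℝ) - 1) * (Fintype.card F - 1) / 2,
        ((Fintype.card (Fˣ ⧸ H) : ℝ) - 1) * (Fintype.card F - 1) / 2,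
        ((Fintype.card F : ℝ) - 1) / 2, ((Fintype.card F : ℝ) - 1) / 2,
        (Fintype.card (Fˣ ⧸ H) : ℝ) - 1] : Fin 6 → ℝ) i := by
  have h1 : LinearMap.trace ℝ _ (1 : Module.End ℝ ((Fˣ ⧸ H) × F → ℝ)) =
      (Fintype.card (Fˣ ⧸ H) : ℝ) * Fintype.card F := by
    simp [LinearMap.trace_one]
  fin_cases i <;>
  simp [spectralProjection, h1, trace_adj H h2, trace_averageFst_mul_adj H h2, trace_averageFst,
    trace_averageSnd, trace_averageFst_mul_averageSnd] <;> ring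

end Graph

/-- For odd characteristic, the eigenvalues of `G^×` with multiplicities:
`q-1` once, `±√q` each `((q-1)/t-1)(q-1)/2` times, `±1` each `(q-1)/2` times,
and `0` with multiplicity `(q-1)/t - 1`. -/
theorem stmt19 (p : ℕ) (hp : p.Prime) (hodd : p ≠ 2)
    (F : Type) [Field F] [Fintype F] [DecidableEq F] [CharP F p]
    (t : ℕ) (ht : 2 ≤ t) (hdvd : t ∣ (Fintype.card F - 1))
    (H : Subgroup Fˣ) (hH : Nat.card H = t) [Fintype (Fˣ ⧸ H)] :
    let q := Fintype.card F
    let M := (adjMatrixTimes H).mulVecLin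
    Module.finrank ℝ (Module.End.eigenspace M ((q : ℝ) - 1)) = 1 ∧
    Module.finrank ℝ (Module.End.eigenspace M (Real.sqrt q)) =
        ((q - 1) / t - 1) * (q - 1) / 2 ∧
    Module.finrank ℝ (Module.End.eigenspace M (-Real.sqrt q)) =
        ((q - 1) / t - 1) * (q - 1) / 2 ∧
    Module.finrank ℝ (Module.End.eigenspace M 1) = (q - 1) / 2 ∧
    Module.finrank ℝ (Module.End.eigenspace M (-1)) = (q - 1) / 2 ∧
    Module.finrank ℝ (Module.End.eigenspace M 0) = (q - 1) / t - 1 := by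
  intro q M
  have hq2 : (2 : F) ≠ 0 := Ring.two_ne_zero (by rwa [ringChar.eq F p])
  obtain ⟨k, hk⟩ : Odd q := by
    have h := FiniteField.odd_card_of_char_ne_two (F := F) (by rwa [ringChar.eq F p])
    exact Nat.odd_iff.mpr h
  have hcard : 1 < q := Fintype.one_lt_card
  have hn : (q - 1) / t = Fintype.card (Fˣ ⧸ H) := by
    have h := natCard_mul_card_quotient H
    rw [hH, eq_sub_iff_add_eq] at h
    have h' : t * Fintype.card (Fˣ ⧸ H) + 1 = q := by exact_mod_cast h
    rw [← h', Nat.add_sub_cancel, Nat.mul_div_cancel_left _ (by omega)]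
  have hq3 : (3 : ℝ) ≤ q := by
    have : 3 ≤ q := by omega
    exact_mod_cast this
  have key := fun i => (finrank_eigenspace_eq_trace_s19 M (spectralProjection H) (adjEigenvalue q)
    (adjEigenvalue_injective hq3) (sum_spectralProjection H) (adj_mul_spectralProjection H)
    (spectralProjection_mul_adj H) i).trans (trace_spectralProjection H hq2 i)
  obtain ⟨m, hm⟩ : ∃ m, Fintype.card (Fˣ ⧸ H) = m + 1 :=
    Nat.exists_eq_succ_of_ne_zero Fintype.card_ne_zero
  have hqk : (Fintype.card F : ℝ) = 2 * k + 1 := by exact_mod_cast hk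
  have e1 : (q - 1) / 2 = k := by omega
  have e2 : ((q - 1) / t - 1) * (q - 1) / 2 = m * k := by
    rw [hn, hm, hk, Nat.add_sub_cancel, Nat.add_sub_cancel, Nat.mul_left_comm]
    exact Nat.mul_div_cancel_left _ two_pos
  have e3 : (q - 1) / t - 1 = m := by omega
  rw [e1, e2, e3]
  have hmr : (Fintype.card (Fˣ ⧸ H) : ℝ) = m + 1 := by exact_mod_cast hm
  refine ⟨?_, ?_, ?_, ?_, ?_, ?_⟩
  · have h : (Module.finrank ℝ (Module.End.eigenspace M ((q : ℝ) - 1)) : ℝ) =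
        1 := key 0
    exact_mod_cast h
  · have h : (Module.finrank ℝ (Module.End.eigenspace M √q) : ℝ) =
        ((Fintype.card (Fˣ ⧸ H) : ℝ) - 1) * (Fintype.card F - 1) / 2 := key 1
    exact_mod_cast h.trans (show _ = (m : ℝ) * k by rw [hqk, hmr]; ring)
  · have h : (Module.finrank ℝ (Module.End.eigenspace M (-√q)) : ℝ) =
        ((Fintype.card (Fˣ ⧸ H) : ℝ) - 1) * (Fintype.card F - 1) / 2 := key 2
    exact_mod_cast h.trans (show _ = (m : ℝ) * k by rw [hqk, hmr]; ring)
  · have h : (Module.finrank ℝ (Module.End.eigenspace M 1) : ℝ) =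
        ((Fintype.card F : ℝ) - 1) / 2 := key 3
    exact_mod_cast h.trans (show _ = (k : ℝ) by rw [hqk]; ring)
  · have h : (Module.finrank ℝ (Module.End.eigenspace M (-1)) : ℝ) =
        ((Fintype.card F : ℝ) - 1) / 2 := key 4
    exact_mod_cast h.trans (show _ = (k : ℝ) by rw [hqk]; ring)
  · have h : (Module.finrank ℝ (Module.End.eigenspace M 0) : ℝ) =
        (Fintype.card (Fˣ ⧸ H) : ℝ) - 1 := key 5
    exact_mod_cast h.trans (show _ = (m : ℝ) by rw [hmr]; ring)
end
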